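/- Let V be a vertex operator algebra and let W be a complex vector space equipped with a linear map Y_W(·,x) satisfying the truncation condition and the Jacobi identity for Y_W. Then for every u, v ∈ V and w ∈ W there exist nonnegative integers k(u,v) and l(u,w) and a (nonunique) element F(u,v,w;x_0,x_1,x_2) of W((x_0,x_1,x_2)) such that x_0^{k(u,v)} F(u,v,w;x_0,x_1,x_2) ∈ W[[x_0]]((x_1,x_2)), x_1^{l(u,w)} F(u,v,w;x_0,x_1,x_2) ∈ W[[x_1]]((x_0,x_2)), and Y_W(u,x_1)Y_W(v,x_2)w = F(u,v,w;x_1−x_2,x_1,x_2), Y_W(v,x_2)Y_W(u,x_1)w = F(u,v,w;−x_2+x_1,x_1,x_2), Y_W(Y(u,x_0)v,x_2)w = F(u,v,w;x_0,x_2+x_0,x_2), all substitutions taken with the binomial expansion convention. Conversely, if W is a complex vector space with a linear map Y_W(·,x) satisfying the truncation condition, and if for every u, v ∈ V and w ∈ W such an F exists with the above three pole conditions and three identities (the nonnegative integers k and l now allowed to depend on all three of u, v, w), then the Jacobi identity for Y_W holds. -/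

import Mathlib

noncomputable section

open scoped BigOperators

/-- Generalized binomial coefficient `z(z-1)⋯(z-k+1)/k!`. -/
def cbinom (z : ℂ) (k : ℕ) : ℂ :=
  (∏ j ∈ Finset.range k, (z - (j : ℂ))) / (k.factorial : ℂ)

/-- Generalized binomial coefficient with integer lower index (zero for negative index). -/
def cbinomZ (z : ℂ) (k : ℤ) : ℂ := if 0 ≤ k then cbinom z k.toNat else 0

/-- A vertex operator algebra `(V, Y, 𝟙, ω)` over `ℂ`, described in terms of the modes
`vₙ = Y v n` of the vertex operators `Y(v,x) = ∑ₙ vₙ x^{-n-1}`.  The Jacobi identity is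
expressed in its equivalent component (Borcherds identity) form: it is the equality of the
coefficients of `x₀^{-n-1} x₁^{-a-1} x₂^{-b-1}` on the two sides of the formal-variable
Jacobi identity, with all binomials expanded by the binomial expansion convention. -/
structure VOA (V : Type) [AddCommGroup V] [Module ℂ V] where
  Y : V →ₗ[ℂ] ℤ → Module.End ℂ V
  vac : V
  conf : V
  cc : ℂ
  grade : ℤ → Submodule ℂ V
  internal : DirectSum.IsInternal grade
  findim : ∀ n : ℤ, FiniteDimensional ℂ (grade n)
  bddBelow : ∃ N : ℤ, ∀ n < N, grade n = ⊥
  trunc : ∀ u v : V, ∃ N : ℤ, ∀ n ≥ N, Y u n v = 0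
  vacuum : ∀ n : ℤ, Y vac n = if n = -1 then 1 else 0
  creation_zero : ∀ (v : V) (n : ℤ), 0 ≤ n → Y v n vac = 0
  creation_id : ∀ v : V, Y v (-1) vac = v
  virasoro : ∀ m n : ℤ,
    Y conf (m + 1) * Y conf (n + 1) - Y conf (n + 1) * Y conf (m + 1)
      = ((m - n : ℤ) : ℂ) • Y conf (m + n + 1)
        + (if m + n = 0 then ((m ^ 3 - m : ℤ) : ℂ) / 12 * cc else 0) •
            (1 : Module.End ℂ V)
  L0_grade : ∀ n : ℤ, ∀ v ∈ grade n, Y conf 1 v = (n : ℂ) • v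
  L_neg_one : ∀ (u : V) (n : ℤ), Y (Y conf 0 u) n = (-n : ℂ) • Y u (n - 1)
  jacobi : ∀ (u v w : V) (a n b : ℤ),
    (∑ᶠ i : ℕ, cbinom (a : ℂ) i • Y (Y u (n + i) v) (a + b - i) w)
      = (∑ᶠ i : ℕ, ((-1 : ℂ) ^ i * cbinom (n : ℂ) i) • Y u (a + n - i) (Y v (b + i) w))
        - (-1 : ℂ) ^ n •
            (∑ᶠ i : ℕ, ((-1 : ℂ) ^ i * cbinom (n : ℂ) i) • Y v (b + n - i) (Y u (a + i) w))

variable {V W : Type} [AddCommGroup V] [Module ℂ V] [AddCommGroup W] [Module ℂ W]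

/-- Truncation condition for a module-type vertex operator map. -/
def TruncW (YW : V →ₗ[ℂ] ℤ → Module.End ℂ W) : Prop :=
  ∀ (v : V) (w : W), ∃ N : ℤ, ∀ n ≥ N, YW v n w = 0

/-- The Jacobi identity for a module map `Y_W`, in component form. -/
def JacobiW (𝒜 : VOA V) (YW : V →ₗ[ℂ] ℤ → Module.End ℂ W) : Prop :=
  ∀ (u v : V) (w : W) (a n b : ℤ),
    (∑ᶠ i : ℕ, cbinom (a : ℂ) i • YW (𝒜.Y u (n + i) v) (a + b - i) w)
      = (∑ᶠ i : ℕ, ((-1 : ℂ) ^ i * cbinom (n : ℂ) i) • YW u (a + n - i) (YW v (b + i) w))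
        - (-1 : ℂ) ^ n •
            (∑ᶠ i : ℕ, ((-1 : ℂ) ^ i * cbinom (n : ℂ) i) • YW v (b + n - i) (YW u (a + i) w))

/-- `F` is an element of `W((x₀,x₁,x₂))`: only finitely many negative powers of each
variable, with a common bound. `F n₀ n₁ n₂` is the coefficient of `x₀^{n₀} x₁^{n₁} x₂^{n₂}`. -/
def IsLaurent3 (F : ℤ → ℤ → ℤ → W) : Prop :=
  ∃ N : ℕ, ∀ n0 n1 n2 : ℤ, (n0 < -(N : ℤ) ∨ n1 < -(N : ℤ) ∨ n2 < -(N : ℤ)) → F n0 n1 n2 = 0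

/-- `x₀^k F ∈ W[[x₀]]((x₁,x₂))`. -/
def PoleBound0 (k : ℕ) (F : ℤ → ℤ → ℤ → W) : Prop :=
  ∀ n0 n1 n2 : ℤ, n0 < -(k : ℤ) → F n0 n1 n2 = 0

/-- `x₁^l F ∈ W[[x₁]]((x₀,x₂))`. -/
def PoleBound1 (l : ℕ) (F : ℤ → ℤ → ℤ → W) : Prop :=
  ∀ n0 n1 n2 : ℤ, n1 < -(l : ℤ) → F n0 n1 n2 = 0

/-- `Y_W(u,x₁)Y_W(v,x₂)w = F(x₁-x₂,x₁,x₂)`: equality of the coefficients of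
`x₁^A x₂^B`, with `(x₁-x₂)^{n₀}` expanded in nonnegative integral powers of `x₂`. -/
def SubUV (YW : V →ₗ[ℂ] ℤ → Module.End ℂ W) (u v : V) (w : W) (F : ℤ → ℤ → ℤ → W) : Prop :=
  ∀ A B : ℤ,
    YW u (-A - 1) (YW v (-B - 1) w)
      = ∑ᶠ q : ℤ × ℕ, ((-1 : ℂ) ^ q.2 * cbinom (q.1 : ℂ) q.2) •
          F q.1 (A - q.1 + q.2) (B - q.2)

/-- `Y_W(v,x₂)Y_W(u,x₁)w = F(-x₂+x₁,x₁,x₂)`: equality of the coefficients of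
`x₁^A x₂^B`, with `(-x₂+x₁)^{n₀}` expanded in nonnegative integral powers of `x₁`. -/
def SubVU (YW : V →ₗ[ℂ] ℤ → Module.End ℂ W) (u v : V) (w : W) (F : ℤ → ℤ → ℤ → W) : Prop :=
  ∀ A B : ℤ,
    YW v (-B - 1) (YW u (-A - 1) w)
      = ∑ᶠ q : ℤ × ℕ, ((-1 : ℂ) ^ (q.1 - (q.2 : ℤ)) * cbinom (q.1 : ℂ) q.2) •
          F q.1 (A - q.2) (B - q.1 + q.2)

/-- `Y_W(Y(u,x₀)v,x₂)w = F(x₀,x₂+x₀,x₂)`: equality of the coefficients of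
`x₀^A x₂^B`, with `(x₂+x₀)^{n₁}` expanded in nonnegative integral powers of `x₀`. -/
def SubIter (𝒜 : VOA V) (YW : V →ₗ[ℂ] ℤ → Module.End ℂ W) (u v : V) (w : W)
    (F : ℤ → ℤ → ℤ → W) : Prop :=
  ∀ A B : ℤ,
    YW (𝒜.Y u (-A - 1) v) (-B - 1) w
      = ∑ᶠ q : ℤ × ℕ, cbinom (q.1 : ℂ) q.2 • F (A - q.2) q.1 (B - q.1 + q.2)

theorem cbinom_eq_choose (z : ℂ) (k : ℕ) : cbinom z k = Ring.choose z k := by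
  rw [Ring.choose_eq_smul, cbinom, ← Polynomial.aeval_eq_smeval, Polynomial.aeval_def,
    Polynomial.eval₂_eq_eval_map, descPochhammer_map, descPochhammer_eval_eq_prod_range,
    smul_eq_mul, div_eq_inv_mul]

theorem cbinom_add (z w : ℂ) (k : ℕ) :
    cbinom (z + w) k =
      ∑ ij ∈ Finset.HasAntidiagonal.antidiagonal k, cbinom z ij.1 * cbinom w ij.2 := by
  simp only [cbinom_eq_choose]
  exact Ring.add_choose_eq k (Commute.all z w)

theorem cbinom_zero_left (k : ℕ) : cbinom 0 k = if k = 0 then 1 else 0 := by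
  rw [cbinom_eq_choose, Ring.choose_zero_ite]

theorem cbinom_natCast (n k : ℕ) : cbinom (n : ℂ) k = (n.choose k : ℂ) := by
  rw [cbinom_eq_choose, Ring.choose_natCast]

theorem cbinom_neg_succ (m k : ℕ) :
    cbinom (-((m : ℂ) + 1)) k = (-1) ^ k * ((m + k).choose k : ℂ) := by
  rw [cbinom_eq_choose, Ring.choose_neg,
    show (m : ℂ) + 1 + k - 1 = ((m + k : ℕ) : ℂ) by push_cast; ring,
    Ring.choose_natCast]
  simp [Int.negOnePow_def, Units.smul_def]

theorem cbinomZ_of_neg (z : ℂ) {k : ℤ} (hk : k < 0) : cbinomZ z k = 0 := by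
  simp [cbinomZ, not_le.mpr hk]

theorem cbinomZ_natCast (z : ℂ) (k : ℕ) : cbinomZ z k = cbinom z k := by
  simp [cbinomZ]

theorem neg_one_zpow_eq_of_even_sub {m n : ℤ} (h : Even (m - n)) : (-1 : ℂ) ^ m = (-1 : ℂ) ^ n := by
  have := zpow_add₀ (neg_ne_zero.mpr one_ne_zero : (-1 : ℂ) ≠ 0) (m - n) n
  rw [sub_add_cancel, h.neg_one_zpow, one_mul] at this
  exact this

/-- The three-term identity of binomial coefficients underlying the formal delta function
identity `x₀⁻¹δ((x₁-x₂)/x₀) - x₀⁻¹δ((x₂-x₁)/(-x₀)) = x₂⁻¹δ((x₁-x₀)/x₂)`. -/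
theorem cbinomZ_three_term {P Q R : ℤ} (h : P + Q + R = -2) :
    (-1 : ℂ) ^ (-1 - R) * cbinomZ P (-1 - R) - (-1 : ℂ) ^ (P + (-1 - Q)) * cbinomZ P (-1 - Q)
      = cbinomZ Q (-1 - P) := by
  obtain rfl : R = -2 - P - Q := by omega
  rw [show -1 - (-2 - P - Q) = P + Q + 1 by ring]
  have hs : (-1 : ℂ) ^ (P + (-1 - Q)) = (-1) ^ (P + Q + 1) :=
    neg_one_zpow_eq_of_even_sub ⟨-1 - Q, by ring⟩
  rw [hs, ← mul_sub]
  rcases le_or_gt 0 P with hP | hP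
  · rw [cbinomZ_of_neg (Q : ℂ) (by omega)]
    rcases lt_or_ge (-1 - Q) 0 with h1 | h1
    · obtain ⟨p, rfl⟩ := Int.eq_ofNat_of_zero_le hP
      obtain ⟨t, ht⟩ := Int.eq_ofNat_of_zero_le (show (0 : ℤ) ≤ p + Q + 1 by omega)
      rw [cbinomZ_of_neg _ h1, ht, cbinomZ_natCast, Int.cast_natCast, cbinom_natCast,
        Nat.choose_eq_zero_of_lt (by omega)]
      simp
    · rcases lt_or_ge (P + Q + 1) 0 with h2 | h2
      · obtain ⟨p, rfl⟩ := Int.eq_ofNat_of_zero_le hP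
        obtain ⟨t, ht⟩ := Int.eq_ofNat_of_zero_le h1
        rw [cbinomZ_of_neg _ h2, ht, cbinomZ_natCast, Int.cast_natCast, cbinom_natCast,
          Nat.choose_eq_zero_of_lt (by omega)]
        simp
      · obtain ⟨t, ht⟩ := Int.eq_ofNat_of_zero_le h1
        obtain ⟨r, hr⟩ := Int.eq_ofNat_of_zero_le h2
        obtain rfl : P = ((t + r : ℕ) : ℤ) := by push_cast; omega
        rw [ht, hr, cbinomZ_natCast, cbinomZ_natCast, Int.cast_natCast, cbinom_natCast,
          cbinom_natCast, Nat.choose_symm_add, sub_self, mul_zero]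
  · obtain ⟨s, hs'⟩ := Int.eq_ofNat_of_zero_le (show 0 ≤ -1 - P by omega)
    obtain rfl : P = -((s : ℤ) + 1) := by omega
    rw [hs', cbinomZ_natCast]
    have hcast : ((-((s : ℤ) + 1) : ℤ) : ℂ) = -((s : ℂ) + 1) := by push_cast; ring
    rw [hcast]
    rcases le_or_gt 0 Q with hQ | hQ
    · obtain ⟨q, rfl⟩ := Int.eq_ofNat_of_zero_le hQ
      rw [cbinomZ_of_neg _ (show -1 - (q : ℤ) < 0 by omega), sub_zero, Int.cast_natCast,
        cbinom_natCast]
      rcases lt_or_ge (-((s : ℤ) + 1) + q + 1) 0 with h2 | h2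
      · rw [cbinomZ_of_neg _ h2, Nat.choose_eq_zero_of_lt (by omega)]
        simp
      · obtain ⟨r, hr⟩ := Int.eq_ofNat_of_zero_le h2
        obtain rfl : q = s + r := by omega
        rw [hr, cbinomZ_natCast, cbinom_neg_succ, zpow_natCast, ← mul_assoc, ← mul_pow,
          Nat.choose_symm_add]
        simp
    · obtain ⟨t, ht⟩ := Int.eq_ofNat_of_zero_le (show 0 ≤ -1 - Q by omega)
      obtain rfl : Q = -((t : ℤ) + 1) := by omega
      have hcast' : ((-((t : ℤ) + 1) : ℤ) : ℂ) = -((t : ℂ) + 1) := by push_cast; ring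
      rw [cbinomZ_of_neg _ (show -((s : ℤ) + 1) + -((t : ℤ) + 1) + 1 < 0 by omega), ht,
        cbinomZ_natCast, hcast', cbinom_neg_succ, cbinom_neg_succ,
        show -((s : ℤ) + 1) + -((t : ℤ) + 1) + 1 = -((s + t + 1 : ℕ) : ℤ) by push_cast; ring,
        zpow_neg, zpow_natCast, add_comm t s, Nat.choose_symm_add]
      rw [← inv_pow, inv_neg_one]
      rcases neg_one_pow_eq_or ℂ s with hs | hs <;> rcases neg_one_pow_eq_or ℂ t with ht | ht <;>
        simp [pow_add, hs, ht]

theorem finsum_smul_finsum_conv (c d : ℕ → ℂ) (g : ℕ → W) (S : ℕ)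
    (hg : ∀ s, S ≤ s → g s = 0) :
    ∑ᶠ i : ℕ, c i • ∑ᶠ j : ℕ, d j • g (i + j)
      = ∑ᶠ s : ℕ, (∑ ij ∈ Finset.HasAntidiagonal.antidiagonal s, c ij.1 * d ij.2) • g s := by
  have h2 : ∀ i, ∑ᶠ j : ℕ, d j • g (i + j) = ∑ j ∈ Finset.range (S - i), d j • g (i + j) := by
    intro i
    refine finsum_eq_sum_of_support_subset _ fun j hj => ?_
    by_contra h
    simp only [Finset.coe_range, Set.mem_Iio, not_lt] at h
    exact hj (by simp [hg (i + j) (by omega)])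
  rw [finsum_eq_sum_of_support_subset (s := Finset.range S),
    finsum_eq_sum_of_support_subset (s := Finset.range S)]
  · simp only [h2, Finset.smul_sum, Finset.sum_smul]
    rw [← Finset.sum_range_diag_flip S (fun i j => c i • d j • g (i + j))]
    refine Finset.sum_congr rfl fun s _ => ?_
    rw [Finset.Nat.sum_antidiagonal_eq_sum_range_succ (fun i j => (c i * d j) • g s)]
    refine Finset.sum_congr rfl fun i hi => ?_
    rw [Finset.mem_range] at hi
    rw [mul_smul, Nat.add_sub_cancel' (by omega)]
  · intro s hs
    by_contra h
    simp only [Finset.coe_range, Set.mem_Iio, not_lt] at h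
    exact hs (by simp [hg s h])
  · intro i hi
    by_contra h
    simp only [Finset.coe_range, Set.mem_Iio, not_lt] at h
    exact hi (by simp [h2, Nat.sub_eq_zero_of_le h])

theorem finsum_prod_eq_sum_finsum {M : Type*} [AddCommGroup M] (f : ℤ × ℕ → M)
    (P : Finset ℤ) (S : ℕ)
    (hf : ∀ p s, (p ∉ P ∨ S ≤ s) → f (p, s) = 0) :
    ∑ᶠ q : ℤ × ℕ, f q = ∑ p ∈ P, ∑ᶠ s : ℕ, f (p, s) := by
  rw [finsum_curry]
  · refine finsum_eq_sum_of_support_subset _ fun p hp => ?_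
    by_contra h
    exact hp (by simp [fun s => hf p s (Or.inl h)])
  · refine Set.Finite.subset (P ×ˢ Finset.range S).finite_toSet fun q hq => ?_
    by_contra h
    simp only [Finset.coe_product, Set.mem_prod, Finset.mem_coe, Finset.mem_range, not_and_or,
      not_lt] at h
    exact hq (hf q.1 q.2 h)

theorem finsum_smul_finsum_prod_conv (c : ℕ → ℂ) (d : ℤ → ℕ → ℂ) (g : ℤ → ℕ → W)
    (P : Finset ℤ) (S : ℕ) (hg : ∀ p s, (p ∉ P ∨ S ≤ s) → g p s = 0) :
    ∑ᶠ i : ℕ, c i • ∑ᶠ q : ℤ × ℕ, d q.1 q.2 • g q.1 (i + q.2)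
      = ∑ᶠ q : ℤ × ℕ,
          (∑ ij ∈ Finset.HasAntidiagonal.antidiagonal q.2, c ij.1 * d q.1 ij.2) • g q.1 q.2 := by
  rw [finsum_prod_eq_sum_finsum _ P S fun p s h => by simp [hg p s h]]
  simp only [← fun p => finsum_smul_finsum_conv c (d p) (g p) S fun s hs => hg p s (Or.inr hs)]
  rw [← finsum_sum_comm]
  · refine finsum_congr fun i => ?_
    rw [finsum_prod_eq_sum_finsum _ P S fun p s h => by
      simp [hg p (i + s) (h.imp_right fun h => by omega)], Finset.smul_sum]
  · intro p _
    refine Set.Finite.subset (Finset.range S).finite_toSet fun i hi => ?_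
    by_contra h
    simp only [Finset.coe_range, Set.mem_Iio, not_lt] at h
    exact hi (by simp [fun j => hg p (i + j) (Or.inr (by omega))])

theorem finsum_comp_eq_of_injective {α β M : Type*} [AddCommGroup M] (e : α → β)
    (he : Function.Injective e) (f : β → M) (hf : ∀ b, b ∉ Set.range e → f b = 0) :
    ∑ᶠ a, f (e a) = ∑ᶠ b, f b := by
  rw [← finsum_mem_range he, finsum_mem_inter_support_eq' f _ Set.univ, finsum_mem_univ]
  intro b hb
  simpa using not_imp_comm.mp (hf b) hb

theorem finsum_smul_finsum_subUV {F : ℤ → ℤ → ℤ → W} (hF : IsLaurent3 F) (a n b : ℤ) :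
    ∑ᶠ i : ℕ, ((-1 : ℂ) ^ i * cbinom (n : ℂ) i) •
        ∑ᶠ q : ℤ × ℕ, ((-1 : ℂ) ^ q.2 * cbinom (q.1 : ℂ) q.2) •
          F q.1 (-(a + n - i) - 1 - q.1 + q.2) (-(b + i) - 1 - q.2)
      = ∑ᶠ q : ℤ × ℤ, ((-1 : ℂ) ^ (1 + a + n + q.1 + q.2) *
          cbinomZ ((n + q.1 : ℤ) : ℂ) (1 + a + n + q.1 + q.2)) •
          F q.1 q.2 (-2 - a - n - b - q.1 - q.2) := by
  obtain ⟨N, hN⟩ := hF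
  have key := finsum_smul_finsum_prod_conv (fun i => (-1 : ℂ) ^ i * cbinom (n : ℂ) i)
    (fun p j => (-1 : ℂ) ^ j * cbinom (p : ℂ) j)
    (fun p s => F p (s - a - n - 1 - p) (-b - 1 - s))
    (Finset.Icc (-(N : ℤ)) ((N - b).toNat - a - n - 1 + N)) (N - b).toNat (by
      intro p s h
      rw [Finset.mem_Icc] at h
      by_cases hs : (N - b).toNat ≤ s
      · exact hN _ _ _ (by omega)
      · exact hN _ _ _ (by omega))
  refine (Eq.trans ?_ key).trans ?_
  · refine finsum_congr fun i => congrArg _ (finsum_congr fun q => congrArg _ ?_)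
    congr 1 <;> push_cast <;> ring
  · rw [← finsum_comp_eq_of_injective (fun q : ℤ × ℕ => (q.1, (q.2 : ℤ) - a - n - 1 - q.1))]
    · refine finsum_congr fun q => ?_
      rw [show 1 + a + n + q.1 + ((q.2 : ℤ) - a - n - 1 - q.1) = q.2 by ring, cbinomZ_natCast,
        Int.cast_add, cbinom_add, Finset.mul_sum, zpow_natCast]
      congr 1
      · refine Finset.sum_congr rfl fun ij hij => ?_
        rw [← Finset.HasAntidiagonal.mem_antidiagonal.mp hij, pow_add]
        ring
      · congr 1
        ring
    · rintro ⟨p, s⟩ ⟨p', s'⟩ h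
      simp only [Prod.mk.injEq] at h ⊢
      omega
    · rintro ⟨p, q⟩ h
      rw [cbinomZ_of_neg, mul_zero, zero_smul]
      by_contra h0
      exact h ⟨(p, (1 + a + n + p + q).toNat), by
        simp only [not_lt] at h0; simp only [Prod.mk.injEq, true_and]; omega⟩

theorem finsum_smul_finsum_subVU {F : ℤ → ℤ → ℤ → W} (hF : IsLaurent3 F) (a n b : ℤ) :
    (-1 : ℂ) ^ n • ∑ᶠ i : ℕ, ((-1 : ℂ) ^ i * cbinom (n : ℂ) i) •
        ∑ᶠ q : ℤ × ℕ, ((-1 : ℂ) ^ (q.1 - (q.2 : ℤ)) * cbinom (q.1 : ℂ) q.2) •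
          F q.1 (-(a + i) - 1 - q.2) (-(b + n - i) - 1 - q.1 + q.2)
      = ∑ᶠ q : ℤ × ℤ, ((-1 : ℂ) ^ (n + q.1 + (-1 - a - q.2)) *
          cbinomZ ((n + q.1 : ℤ) : ℂ) (-1 - a - q.2)) •
          F q.1 q.2 (-2 - a - n - b - q.1 - q.2) := by
  obtain ⟨N, hN⟩ := hF
  have key := finsum_smul_finsum_prod_conv (fun i => (-1 : ℂ) ^ i * cbinom (n : ℂ) i)
    (fun p j => (-1 : ℂ) ^ (p - (j : ℤ)) * cbinom (p : ℂ) j)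
    (fun p s => F p (-a - 1 - s) (s - b - n - 1 - p))
    (Finset.Icc (-(N : ℤ)) ((N - a).toNat - b - n - 1 + N)) (N - a).toNat (by
      intro p s h
      rw [Finset.mem_Icc] at h
      by_cases hs : (N - a).toNat ≤ s
      · exact hN _ _ _ (by omega)
      · exact hN _ _ _ (by omega))
  refine (Eq.trans (congrArg _ ?_) (congrArg (fun x => (-1 : ℂ) ^ n • x) key)).trans ?_
  · refine finsum_congr fun i => congrArg _ (finsum_congr fun q => congrArg _ ?_)
    congr 1 <;> push_cast <;> ring
  · rw [← finsum_comp_eq_of_injective (fun q : ℤ × ℕ => (q.1, -1 - a - (q.2 : ℤ))), smul_finsum]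
    · refine finsum_congr fun q => ?_
      rw [show -1 - a - (-1 - a - (q.2 : ℤ)) = q.2 by ring, cbinomZ_natCast,
        Int.cast_add, cbinom_add, Finset.mul_sum, smul_smul, Finset.mul_sum]
      congr 1
      · refine Finset.sum_congr rfl fun ij hij => ?_
        have h1 : (-1 : ℂ) ^ (n + q.1 + (q.2 : ℤ))
            = (-1 : ℂ) ^ n * ((-1 : ℂ) ^ ij.1 * (-1 : ℂ) ^ (q.1 - (ij.2 : ℤ))) := by
          rw [← Finset.HasAntidiagonal.mem_antidiagonal.mp hij, ← zpow_natCast,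
            ← zpow_add₀ (by norm_num), ← zpow_add₀ (by norm_num)]
          exact neg_one_zpow_eq_of_even_sub ⟨ij.2, by push_cast; ring⟩
        rw [h1]
        ring
      · congr 1 <;> ring
    · rintro ⟨p, s⟩ ⟨p', s'⟩ h
      simp only [Prod.mk.injEq] at h ⊢
      omega
    · rintro ⟨p, q⟩ h
      rw [cbinomZ_of_neg, mul_zero, zero_smul]
      by_contra h0
      exact h ⟨(p, (-1 - a - q).toNat), by
        simp only [not_lt] at h0; simp only [Prod.mk.injEq, true_and]; omega⟩

theorem finsum_smul_finsum_subIter {F : ℤ → ℤ → ℤ → W} (hF : IsLaurent3 F) (a n b : ℤ) :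
    ∑ᶠ i : ℕ, cbinom (a : ℂ) i •
        ∑ᶠ q : ℤ × ℕ, cbinom (q.1 : ℂ) q.2 •
          F (-(n + i) - 1 - q.2) q.1 (-(a + b - i) - 1 - q.1 + q.2)
      = ∑ᶠ q : ℤ × ℤ, cbinomZ ((a + q.2 : ℤ) : ℂ) (-1 - n - q.1) •
          F q.1 q.2 (-2 - a - n - b - q.1 - q.2) := by
  obtain ⟨N, hN⟩ := hF
  have key := finsum_smul_finsum_prod_conv (fun i => cbinom (a : ℂ) i)
    (fun p j => cbinom (p : ℂ) j)
    (fun p s => F (-n - 1 - s) p (s - a - b - 1 - p))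
    (Finset.Icc (-(N : ℤ)) ((N - n).toNat - a - b - 1 + N)) (N - n).toNat (by
      intro p s h
      rw [Finset.mem_Icc] at h
      by_cases hs : (N - n).toNat ≤ s
      · exact hN _ _ _ (by omega)
      · exact hN _ _ _ (by omega))
  refine (Eq.trans ?_ key).trans ?_
  · refine finsum_congr fun i => congrArg _ (finsum_congr fun q => congrArg _ ?_)
    congr 1 <;> push_cast <;> ring
  · rw [← finsum_comp_eq_of_injective (fun q : ℤ × ℕ => (-1 - n - (q.2 : ℤ), q.1))]
    · refine finsum_congr fun q => ?_
      rw [show -1 - n - (-1 - n - (q.2 : ℤ)) = q.2 by ring, cbinomZ_natCast,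
        Int.cast_add, cbinom_add]
      congr 1
      congr 1 <;> ring
    · rintro ⟨p, s⟩ ⟨p', s'⟩ h
      simp only [Prod.mk.injEq] at h ⊢
      omega
    · rintro ⟨p, q⟩ h
      rw [cbinomZ_of_neg, zero_smul]
      by_contra h0
      exact h ⟨(q, (-1 - n - p).toNat), by
        simp only [not_lt] at h0; simp only [Prod.mk.injEq, and_true]; omega⟩

/-- The Jacobi identity satisfied by the three expansions of a formal series
`F ∈ W((x₀,x₁,x₂))`. -/
theorem IsLaurent3.jacobi {F : ℤ → ℤ → ℤ → W} (hF : IsLaurent3 F) (a n b : ℤ) :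
    ∑ᶠ i : ℕ, cbinom (a : ℂ) i •
        ∑ᶠ q : ℤ × ℕ, cbinom (q.1 : ℂ) q.2 •
          F (-(n + i) - 1 - q.2) q.1 (-(a + b - i) - 1 - q.1 + q.2)
      = (∑ᶠ i : ℕ, ((-1 : ℂ) ^ i * cbinom (n : ℂ) i) •
          ∑ᶠ q : ℤ × ℕ, ((-1 : ℂ) ^ q.2 * cbinom (q.1 : ℂ) q.2) •
            F q.1 (-(a + n - i) - 1 - q.1 + q.2) (-(b + i) - 1 - q.2))
        - (-1 : ℂ) ^ n • ∑ᶠ i : ℕ, ((-1 : ℂ) ^ i * cbinom (n : ℂ) i) •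
          ∑ᶠ q : ℤ × ℕ, ((-1 : ℂ) ^ (q.1 - (q.2 : ℤ)) * cbinom (q.1 : ℂ) q.2) •
            F q.1 (-(a + i) - 1 - q.2) (-(b + n - i) - 1 - q.1 + q.2) := by
  rw [finsum_smul_finsum_subUV hF, finsum_smul_finsum_subVU hF, finsum_smul_finsum_subIter hF]
  obtain ⟨N, hN⟩ := hF
  have hfin : {q : ℤ × ℤ | F q.1 q.2 (-2 - a - n - b - q.1 - q.2) ≠ 0}.Finite := by
    refine Set.Finite.subset (Finset.Icc (-(N : ℤ)) (-2 - a - n - b + 2 * N) ×ˢ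
      Finset.Icc (-(N : ℤ)) (-2 - a - n - b + 2 * N)).finite_toSet fun q hq => ?_
    by_contra h
    simp only [Finset.coe_product, Set.mem_prod, Finset.mem_coe, Finset.mem_Icc] at h
    exact hq (hN _ _ _ (by omega))
  rw [← finsum_sub_distrib]
  · refine finsum_congr fun q => ?_
    rw [← sub_smul]
    congr 1
    have h3 := cbinomZ_three_term (P := n + q.1) (Q := a + q.2)
      (R := b + (-2 - a - n - b - q.1 - q.2)) (by ring)
    rw [show -1 - (b + (-2 - a - n - b - q.1 - q.2)) = 1 + a + n + q.1 + q.2 by ring,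
      show -1 - (a + q.2) = -1 - a - q.2 by ring, show -1 - (n + q.1) = -1 - n - q.1 by ring] at h3
    exact h3.symm
  · exact hfin.subset fun q hq h0 => hq (by simp [h0])
  · exact hfin.subset fun q hq h0 => hq (by simp [h0])

theorem finsum_cbinom_zero_smul (g : ℕ → W) : ∑ᶠ i : ℕ, cbinom (0 : ℂ) i • g i = g 0 := by
  rw [finsum_eq_single _ 0 fun i hi => by rw [cbinom_zero_left, if_neg hi, zero_smul],
    cbinom_zero_left, if_pos rfl, one_smul]

theorem finsum_cbinom_neg_smul_finsum_cbinom (z : ℂ) (g : ℕ → W) (S : ℕ)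
    (hg : ∀ s, S ≤ s → g s = 0) :
    ∑ᶠ i : ℕ, ((-1 : ℂ) ^ i * cbinom (-z) i) •
      ∑ᶠ j : ℕ, ((-1 : ℂ) ^ j * cbinom z j) • g (i + j) = g 0 := by
  rw [finsum_smul_finsum_conv _ _ g S hg, ← finsum_cbinom_zero_smul g]
  refine finsum_congr fun s => ?_
  have h : ∑ ij ∈ Finset.HasAntidiagonal.antidiagonal s,
      (-1 : ℂ) ^ ij.1 * cbinom (-z) ij.1 * ((-1 : ℂ) ^ ij.2 * cbinom z ij.2)
        = (-1 : ℂ) ^ s * cbinom 0 s := by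
    rw [← neg_add_cancel z, cbinom_add, Finset.mul_sum]
    refine Finset.sum_congr rfl fun ij hij => ?_
    rw [← Finset.HasAntidiagonal.mem_antidiagonal.mp hij, pow_add]
    ring
  rw [h, cbinom_zero_left]
  split_ifs with hs <;> simp [hs]

theorem jacobiW_of_forall_exists {𝒜 : VOA V} {YW : V →ₗ[ℂ] ℤ → Module.End ℂ W}
    (h : ∀ (u v : V) (w : W), ∃ F : ℤ → ℤ → ℤ → W,
      IsLaurent3 F ∧ SubUV YW u v w F ∧ SubVU YW u v w F ∧ SubIter 𝒜 YW u v w F) :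
    JacobiW 𝒜 YW := by
  intro u v w a n b
  obtain ⟨F, hF, hUV, hVU, hI⟩ := h u v w
  rw [SubUV] at hUV
  rw [SubVU] at hVU
  rw [SubIter] at hI
  convert hF.jacobi a n b using 1
  · refine finsum_congr fun i => ?_
    rw [← hI]
    congr 4
    ring_nf
  · congr 1
    · refine finsum_congr fun i => ?_
      rw [← hUV]
      congr 3 <;> ring_nf
    · refine congrArg _ (finsum_congr fun i => ?_)
      rw [← hVU]
      congr 3 <;> ring_nf

theorem subIter_of_subUV_subVU {𝒜 : VOA V} {YW : V →ₗ[ℂ] ℤ → Module.End ℂ W}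
    (hJ : JacobiW 𝒜 YW) {u v : V} {w : W} {F : ℤ → ℤ → ℤ → W} (hF : IsLaurent3 F)
    (hUV : SubUV YW u v w F) (hVU : SubVU YW u v w F) : SubIter 𝒜 YW u v w F := by
  intro A B
  have h1 := hJ u v w 0 (-A - 1) (-B - 1)
  have h2 := hF.jacobi 0 (-A - 1) (-B - 1)
  simp only [← hUV _ _, ← hVU _ _] at h2
  rw [Int.cast_zero, finsum_cbinom_zero_smul] at h1 h2
  convert h1.trans (Eq.trans ?_ h2.symm) using 1
  · congr 4
    simp
  · refine finsum_congr fun q => ?_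
    congr 2 <;> push_cast <;> ring
  · congr 1
    · refine finsum_congr fun i => ?_
      congr 3 <;> ring_nf
    · refine congrArg _ (finsum_congr fun i => ?_)
      congr 3 <;> ring_nf

/-- The coefficients of `(x₁-x₂)^k Y_W(u,x₁)Y_W(v,x₂)w`. -/
def clearedProduct (YW : V →ₗ[ℂ] ℤ → Module.End ℂ W) (k : ℕ) (u v : V) (w : W) (A B : ℤ) : W :=
  ∑ᶠ j : ℕ, ((-1 : ℂ) ^ j * cbinom (k : ℂ) j) •
    YW u (-(A - k + j) - 1) (YW v (-(B - j) - 1) w)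

/-- Weak commutativity. -/
theorem clearedProduct_comm {𝒜 : VOA V} {YW : V →ₗ[ℂ] ℤ → Module.End ℂ W}
    (hJ : JacobiW 𝒜 YW) {u v : V} {k : ℕ} (hk : ∀ n : ℤ, (k : ℤ) ≤ n → 𝒜.Y u n v = 0)
    (w : W) (A B : ℤ) :
    clearedProduct YW k u v w A B = (-1 : ℂ) ^ k •
      ∑ᶠ j : ℕ, ((-1 : ℂ) ^ j * cbinom (k : ℂ) j) •
        YW v (-(B - k + j) - 1) (YW u (-(A - j) - 1) w) := by
  have h := hJ u v w (-A - 1) k (-B - 1)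
  rw [finsum_eq_zero_of_forall_eq_zero fun i => by
    rw [hk (k + i) (by omega)]; simp] at h
  have h' := (sub_eq_zero.mp h.symm)
  rw [clearedProduct]
  convert h' using 1
  · refine finsum_congr fun i => ?_
    congr 3 <;> ring_nf
  · rw [zpow_natCast]
    refine congrArg _ (finsum_congr fun i => ?_)
    congr 3 <;> ring_nf

theorem clearedProduct_eq_zero_of_right {YW : V →ₗ[ℂ] ℤ → Module.End ℂ W} {v : V} {w : W} {N : ℕ}
    (hN : ∀ n : ℤ, (N : ℤ) ≤ n → YW v n w = 0) (k : ℕ) (u : V) (A : ℤ) {B : ℤ}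
    (hB : B < -(N : ℤ)) : clearedProduct YW k u v w A B = 0 :=
  finsum_eq_zero_of_forall_eq_zero fun j => by rw [hN _ (by omega), map_zero, smul_zero]

theorem clearedProduct_eq_zero_of_left {𝒜 : VOA V} {YW : V →ₗ[ℂ] ℤ → Module.End ℂ W}
    (hJ : JacobiW 𝒜 YW) {u v : V} {k : ℕ} (hk : ∀ n : ℤ, (k : ℤ) ≤ n → 𝒜.Y u n v = 0)
    {w : W} {l : ℕ} (hl : ∀ n : ℤ, (l : ℤ) ≤ n → YW u n w = 0) {A : ℤ} (B : ℤ)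
    (hA : A < -(l : ℤ)) : clearedProduct YW k u v w A B = 0 := by
  rw [clearedProduct_comm hJ hk, finsum_eq_zero_of_forall_eq_zero, smul_zero]
  intro j
  rw [hl _ (by omega), map_zero, smul_zero]

/-- The series `x₀⁻ᵏ (x₁-x₂)^k Y_W(u,x₁)Y_W(v,x₂)w`. -/
def correlator (YW : V →ₗ[ℂ] ℤ → Module.End ℂ W) (k : ℕ) (u v : V) (w : W)
    (n0 n1 n2 : ℤ) : W :=
  if n0 = -(k : ℤ) then clearedProduct YW k u v w n1 n2 else 0

theorem finsum_correlator (YW : V →ₗ[ℂ] ℤ → Module.End ℂ W) (k : ℕ) (u v : V) (w : W)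
    (c : ℤ → ℕ → ℂ) (x y : ℤ → ℕ → ℤ) :
    ∑ᶠ q : ℤ × ℕ, c q.1 q.2 • correlator YW k u v w q.1 (x q.1 q.2) (y q.1 q.2)
      = ∑ᶠ i : ℕ, c (-k) i • clearedProduct YW k u v w (x (-k) i) (y (-k) i) := by
  rw [← finsum_comp_eq_of_injective (fun i : ℕ => (-(k : ℤ), i))]
  · simp [correlator]
  · exact fun i j h => (Prod.mk.inj h).2
  · rintro ⟨p, i⟩ h
    rw [correlator, if_neg, smul_zero]
    exact fun h0 => h ⟨i, Prod.ext h0.symm rfl⟩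

theorem subUV_correlator {YW : V →ₗ[ℂ] ℤ → Module.End ℂ W} (hT : TruncW YW) (k : ℕ)
    (u v : V) (w : W) : SubUV YW u v w (correlator YW k u v w) := by
  intro A B
  obtain ⟨N, hN⟩ := hT v w
  rw [finsum_correlator YW k u v w (fun p i => (-1 : ℂ) ^ i * cbinom (p : ℂ) i)
    (fun p i => A - p + i) (fun _ i => B - i)]
  have h := finsum_cbinom_neg_smul_finsum_cbinom (k : ℂ)
    (fun s => YW u (-(A + s) - 1) (YW v (-(B - s) - 1) w)) (N + B + 1).toNat
    fun s hs => by rw [hN _ (by omega), map_zero]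
  convert h.symm using 1
  · simp
  · refine finsum_congr fun i => ?_
    rw [clearedProduct]
    congr 1
    · push_cast; rfl
    · refine finsum_congr fun j => ?_
      congr 3 <;> push_cast <;> ring_nf

theorem subVU_correlator {𝒜 : VOA V} {YW : V →ₗ[ℂ] ℤ → Module.End ℂ W} (hT : TruncW YW)
    (hJ : JacobiW 𝒜 YW) {u v : V} {k : ℕ} (hk : ∀ n : ℤ, (k : ℤ) ≤ n → 𝒜.Y u n v = 0) (w : W) :
    SubVU YW u v w (correlator YW k u v w) := by
  intro A B
  obtain ⟨N, hN⟩ := hT u w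
  rw [finsum_correlator YW k u v w (fun p i => (-1 : ℂ) ^ (p - (i : ℤ)) * cbinom (p : ℂ) i)
    (fun _ i => A - i) (fun p i => B - p + i)]
  have h := finsum_cbinom_neg_smul_finsum_cbinom (k : ℂ)
    (fun s => YW v (-(B + s) - 1) (YW u (-(A - s) - 1) w)) (N + A + 1).toNat
    fun s hs => by rw [hN _ (by omega), map_zero]
  convert h.symm using 1
  · simp
  · refine finsum_congr fun i => ?_
    rw [clearedProduct_comm hJ hk, smul_smul]
    congr 1
    · have h1 : (-1 : ℂ) ^ i = (-1 : ℂ) ^ (-(k : ℤ) - i) * (-1 : ℂ) ^ k := by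
        rw [← zpow_natCast, ← zpow_natCast, ← zpow_add₀ (by norm_num)]
        exact neg_one_zpow_eq_of_even_sub ⟨i, by ring⟩
      rw [h1]
      push_cast
      ring
    · refine finsum_congr fun j => ?_
      congr 3 <;> push_cast <;> ring_nf

theorem exists_nat_of_eventually_zero {M : Type*} [Zero M] {f : ℤ → M}
    (h : ∃ N : ℤ, ∀ n ≥ N, f n = 0) : ∃ N : ℕ, ∀ n : ℤ, (N : ℤ) ≤ n → f n = 0 := by
  obtain ⟨N, hN⟩ := h
  exact ⟨N.toNat, fun n hn => hN n (by omega)⟩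

/-- Theorem 4.1, formal commutativity and associativity for untwisted
modules.  Forward direction: truncation and the Jacobi identity imply the existence, for
every `u, v, w`, of `k = k(u,v)`, `l = l(u,w)` and `F ∈ W((x₀,x₁,x₂))` with the three pole
conditions and the three substitution identities.  Converse: truncation together with the
existence of such data (with `k, l` allowed to depend on all of `u, v, w`) imply the
Jacobi identity. -/
theorem statement0 (𝒜 : VOA V) (YW : V →ₗ[ℂ] ℤ → Module.End ℂ W) :
    (TruncW YW → JacobiW 𝒜 YW →
      ∃ (k : V → V → ℕ) (l : V → W → ℕ),
        ∀ (u v : V) (w : W), ∃ F : ℤ → ℤ → ℤ → W,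
          IsLaurent3 F ∧ PoleBound0 (k u v) F ∧ PoleBound1 (l u w) F ∧
          SubUV YW u v w F ∧ SubVU YW u v w F ∧ SubIter 𝒜 YW u v w F)
    ∧ (TruncW YW →
       (∀ (u v : V) (w : W), ∃ (k l : ℕ) (F : ℤ → ℤ → ℤ → W),
          IsLaurent3 F ∧ PoleBound0 k F ∧ PoleBound1 l F ∧
          SubUV YW u v w F ∧ SubVU YW u v w F ∧ SubIter 𝒜 YW u v w F) →
       JacobiW 𝒜 YW) := by
  refine ⟨fun hT hJ => ?_, fun _ h => ?_⟩
  · choose k hk using fun u v => exists_nat_of_eventually_zero (𝒜.trunc u v)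
    choose l hl using fun u w => exists_nat_of_eventually_zero (hT u w)
    refine ⟨k, l, fun u v w => ⟨correlator YW (k u v) u v w, ?_⟩⟩
    have hF : IsLaurent3 (correlator YW (k u v) u v w) := by
      refine ⟨max (k u v) (max (l u w) (l v w)), fun n0 n1 n2 h => ?_⟩
      rw [correlator]
      split_ifs with h0
      · rcases h with h | h | h
        · omega
        · exact clearedProduct_eq_zero_of_left hJ (hk u v) (hl u w) _ (by omega)
        · exact clearedProduct_eq_zero_of_right (hl v w) _ _ _ (by omega)
      · rfl
    have hUV := subUV_correlator hT (k u v) u v w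
    have hVU := subVU_correlator hT hJ (hk u v) w
    refine ⟨hF, fun n0 n1 n2 h => if_neg (by omega), fun n0 n1 n2 h => ?_, hUV, hVU,
      subIter_of_subUV_subVU hJ hF hUV hVU⟩
    rw [correlator, clearedProduct_eq_zero_of_left hJ (hk u v) (hl u w) _ h, ite_self]
  · refine jacobiW_of_forall_exists fun u v w => ?_
    obtain ⟨_, _, F, hF, _, _, hUV, hVU, hI⟩ := h u v w
    exact ⟨F, hF, hUV, hVU, hI⟩
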